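/- Let f(x, W) = f̃(W₁x, W₂) with f̃ differentiable, let W* = (W₁*, W₂*), let x* ∈ ℝ^d with x* ≠ 0, and let k ≥ 1. Assume f satisfies the (C, δ_approx, k)-local smoothness condition at data x* and parameters W*: for every W' with ‖W' − W*‖₂ ≤ δ_approx, ‖∇_W f(x*, W')‖_{2k} ≤ C(‖∇_W f(x*, W*)‖_{2k} + 1). Then for every x ∈ ℝ^d with ‖x − x*‖₂ ≤ δ_approx ‖x*‖₂ / ‖W₁*‖₂, one has ‖∇_x f(x, W*)‖_{2k} ≤ (C ‖(W₁*)ᵀ‖_{2k} / ‖x*‖_{2k}) · (‖∇_W f(x*, W*)‖_{2k} + 1). -/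

import Mathlib

/-- Matrix–vector product of `W : ℝ^{m×d}` (as a function) with `x : ℝ^d`. -/
noncomputable def mVec {m d : ℕ} (W : Fin m → Fin d → ℝ) (x : Fin d → ℝ) : Fin m → ℝ :=
  fun r => ∑ s, W r s * x s

/-- Euclidean (ℓ²) norm of a vector in `ℝ^d`. -/
noncomputable def l2norm {d : ℕ} (v : Fin d → ℝ) : ℝ := Real.sqrt (∑ j, v j ^ 2)

/-- Operator norm of a matrix induced by Euclidean norms. -/
noncomputable def opNorm2 {m d : ℕ} (W : Fin m → Fin d → ℝ) : ℝ :=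
  sSup {r : ℝ | ∃ x : Fin d → ℝ, l2norm x = 1 ∧ r = l2norm (mVec W x)}

/-- ℓ^{2k} norm of a vector. -/
noncomputable def lpnorm (k : ℕ) {d : ℕ} (v : Fin d → ℝ) : ℝ :=
  (∑ j, |v j| ^ (2 * k)) ^ ((2 * k : ℝ))⁻¹

/-- Operator norm of a matrix induced by ℓ^{2k} norms on domain and codomain. -/
noncomputable def opNormP (k : ℕ) {m d : ℕ} (W : Fin m → Fin d → ℝ) : ℝ :=
  sSup {r : ℝ | ∃ x : Fin d → ℝ, lpnorm k x = 1 ∧ r = lpnorm k (mVec W x)}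

/-- Euclidean distance between two (flattened) parameter pairs `W = (W₁, W₂)`. -/
noncomputable def paramDist {m d p : ℕ}
    (W W' : (Fin m → Fin d → ℝ) × (Fin p → ℝ)) : ℝ :=
  Real.sqrt ((∑ r, ∑ s, (W.1 r s - W'.1 r s) ^ 2) + ∑ l, (W.2 l - W'.2 l) ^ 2)

/-- The ℓ^{2k} norm `‖∇_W F‖_{2k}` of the gradient of `F : (W₁, W₂) ↦ ℝ` with respect to all
(flattened) parameters. -/
noncomputable def gradWnorm {m d p : ℕ} (k : ℕ)
    (F : ((Fin m → Fin d → ℝ) × (Fin p → ℝ)) → ℝ)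
    (W : (Fin m → Fin d → ℝ) × (Fin p → ℝ)) : ℝ :=
  ((∑ r, ∑ s, |fderiv ℝ F W (Pi.single r (Pi.single s 1), 0)| ^ (2 * k))
    + ∑ l, |fderiv ℝ F W (0, Pi.single l 1)| ^ (2 * k)) ^ ((2 * k : ℝ))⁻¹

lemma lpnorm_nonneg (k : ℕ) {d : ℕ} (v : Fin d → ℝ) : 0 ≤ lpnorm k v :=
  Real.rpow_nonneg (Finset.sum_nonneg fun _ _ => by positivity) _

lemma lpnorm_pow {k : ℕ} (hk : 1 ≤ k) {d : ℕ} (v : Fin d → ℝ) :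
    lpnorm k v ^ (2 * k) = ∑ j, |v j| ^ (2 * k) := by
  have h : ((2 * k : ℝ))⁻¹ = (((2 * k : ℕ) : ℝ))⁻¹ := by push_cast; rfl
  rw [lpnorm, h]
  exact Real.rpow_inv_natCast_pow (Finset.sum_nonneg fun _ _ => by positivity) (by omega)

lemma lpnorm_mono {k : ℕ} {d : ℕ} {v w : Fin d → ℝ} (h : ∀ j, |v j| ≤ |w j|) :
    lpnorm k v ≤ lpnorm k w :=
  Real.rpow_le_rpow (Finset.sum_nonneg fun _ _ => by positivity)
    (Finset.sum_le_sum fun j _ => pow_le_pow_left₀ (abs_nonneg _) (h j) _) (by positivity)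

lemma abs_le_lpnorm {k : ℕ} (hk : 1 ≤ k) {d : ℕ} (v : Fin d → ℝ) (j : Fin d) :
    |v j| ≤ lpnorm k v := by
  refine le_of_pow_le_pow_left₀ (n := 2 * k) (by omega) (lpnorm_nonneg k v) ?_
  rw [lpnorm_pow hk]
  exact Finset.single_le_sum (f := fun j => |v j| ^ (2 * k)) (fun _ _ => by positivity)
    (Finset.mem_univ j)

lemma lpnorm_pos {k : ℕ} (hk : 1 ≤ k) {d : ℕ} {v : Fin d → ℝ} (hv : v ≠ 0) :
    0 < lpnorm k v := by
  obtain ⟨j, hj⟩ := Function.ne_iff.mp hv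
  exact (abs_pos.mpr hj).trans_le (abs_le_lpnorm hk v j)

lemma lpnorm_smul {k : ℕ} (hk : 1 ≤ k) {d : ℕ} (c : ℝ) (v : Fin d → ℝ) :
    lpnorm k (c • v) = |c| * lpnorm k v := by
  refine (pow_left_inj₀ (lpnorm_nonneg k _) (mul_nonneg (abs_nonneg c) (lpnorm_nonneg k v))
    (n := 2 * k) (by omega)).mp ?_
  rw [mul_pow, lpnorm_pow hk, lpnorm_pow hk, Finset.mul_sum]
  simp [abs_mul, mul_pow]

lemma lpnorm_one {d : ℕ} (v : Fin d → ℝ) : lpnorm 1 v = l2norm v := by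
  simp [lpnorm, l2norm, Real.sqrt_eq_rpow]

lemma opNormP_one {m d : ℕ} (W : Fin m → Fin d → ℝ) : opNormP 1 W = opNorm2 W := by
  simp only [opNormP, opNorm2, lpnorm_one]

lemma mVec_smul {m d : ℕ} (W : Fin m → Fin d → ℝ) (c : ℝ) (v : Fin d → ℝ) :
    mVec W (c • v) = c • mVec W v := by
  ext r
  simp only [mVec, Pi.smul_apply, smul_eq_mul, Finset.mul_sum]
  exact Finset.sum_congr rfl fun s _ => by ring

lemma bddAbove_opNormP {k : ℕ} (hk : 1 ≤ k) {m d : ℕ} (W : Fin m → Fin d → ℝ) :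
    BddAbove {r : ℝ | ∃ x : Fin d → ℝ, lpnorm k x = 1 ∧ r = lpnorm k (mVec W x)} := by
  refine ⟨lpnorm k fun r => ∑ s, |W r s|, ?_⟩
  rintro _ ⟨x, hx, rfl⟩
  refine lpnorm_mono fun r => ?_
  rw [abs_of_nonneg (Finset.sum_nonneg fun s _ => abs_nonneg (W r s))]
  refine (Finset.abs_sum_le_sum_abs _ _).trans (Finset.sum_le_sum fun s _ => ?_)
  rw [abs_mul]
  exact mul_le_of_le_one_right (abs_nonneg _) (hx ▸ abs_le_lpnorm hk x s)

lemma opNormP_nonneg (k : ℕ) {m d : ℕ} (W : Fin m → Fin d → ℝ) : 0 ≤ opNormP k W := by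
  refine Real.sSup_nonneg ?_
  rintro _ ⟨x, -, rfl⟩
  exact lpnorm_nonneg k _

lemma lpnorm_mVec_le {k : ℕ} (hk : 1 ≤ k) {m d : ℕ} (W : Fin m → Fin d → ℝ)
    (v : Fin d → ℝ) : lpnorm k (mVec W v) ≤ opNormP k W * lpnorm k v := by
  rcases eq_or_ne v 0 with rfl | hv
  · have h : mVec W (0 : Fin d → ℝ) = (0 : ℝ) • mVec W 0 := by rw [← mVec_smul, zero_smul]
    rw [h, lpnorm_smul hk, abs_zero, zero_mul]
    exact mul_nonneg (opNormP_nonneg k W) (lpnorm_nonneg k _)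
  · have hpos := lpnorm_pos hk hv
    have h : lpnorm k (mVec W ((lpnorm k v)⁻¹ • v)) ≤ opNormP k W := by
      refine le_csSup (bddAbove_opNormP hk W) ⟨_, ?_, rfl⟩
      rw [lpnorm_smul hk, abs_of_pos (inv_pos.mpr hpos), inv_mul_cancel₀ hpos.ne']
    rwa [mVec_smul, lpnorm_smul hk, abs_of_pos (inv_pos.mpr hpos), inv_mul_le_iff₀ hpos,
      mul_comm] at h

/-- `mVec W` as a continuous linear map. -/
noncomputable def mVecCLM {m d : ℕ} (W : Fin m → Fin d → ℝ) :
    (Fin d → ℝ) →L[ℝ] (Fin m → ℝ) :=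
  LinearMap.toContinuousLinearMap
    { toFun := mVec W
      map_add' := fun x y => by ext r; simp [mVec, mul_add, Finset.sum_add_distrib]
      map_smul' := fun c x => mVec_smul W c x }

/-- The map `(W₁, W₂) ↦ (W₁ x, W₂)` as a continuous linear map. -/
noncomputable def paramCLM {m d : ℕ} (p : ℕ) (x : Fin d → ℝ) :
    ((Fin m → Fin d → ℝ) × (Fin p → ℝ)) →L[ℝ] (Fin m → ℝ) × (Fin p → ℝ) :=
  LinearMap.toContinuousLinearMap
    { toFun := fun V => (mVec V.1 x, V.2)
      map_add' := fun V V' => by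
        ext r <;> simp [mVec, add_mul, Finset.sum_add_distrib]
      map_smul' := fun c V => by
        ext r <;> simp [mVec, mul_assoc, Finset.mul_sum] }

lemma mVec_single {m d : ℕ} (W : Fin m → Fin d → ℝ) (j : Fin d) :
    mVec W (Pi.single j 1) = fun r => W r j := by
  ext r
  simp [mVec, Pi.single_apply]

lemma mVec_single_single {m d : ℕ} (r : Fin m) (s : Fin d) (x : Fin d → ℝ) :
    mVec (Pi.single r (Pi.single s 1)) x = x s • (Pi.single r 1 : Fin m → ℝ) := by
  ext r'
  by_cases h : r' = r
  · subst h
    simp [mVec, Pi.single_apply]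
  · simp [mVec, h]

section Gradients

variable {m d p : ℕ} {ft : (Fin m → ℝ) → (Fin p → ℝ) → ℝ}

lemma fderiv_comp_input
    (hft : Differentiable ℝ (fun q : (Fin m → ℝ) × (Fin p → ℝ) => ft q.1 q.2))
    (W : (Fin m → Fin d → ℝ) × (Fin p → ℝ)) (x v : Fin d → ℝ) :
    fderiv ℝ (fun z => ft (mVec W.1 z) W.2) x v
      = fderiv ℝ (fun q : (Fin m → ℝ) × (Fin p → ℝ) => ft q.1 q.2) (mVec W.1 x, W.2)
          (mVec W.1 v, 0) := by
  have h := (hft (mVec W.1 x, W.2)).hasFDerivAt.comp x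
    ((mVecCLM W.1).hasFDerivAt.prodMk (hasFDerivAt_const W.2 x))
  exact congrArg (fun L => L v) h.fderiv

lemma fderiv_comp_param
    (hft : Differentiable ℝ (fun q : (Fin m → ℝ) × (Fin p → ℝ) => ft q.1 q.2))
    (x : Fin d → ℝ) (W V : (Fin m → Fin d → ℝ) × (Fin p → ℝ)) :
    fderiv ℝ (fun V => ft (mVec V.1 x) V.2) W V
      = fderiv ℝ (fun q : (Fin m → ℝ) × (Fin p → ℝ) => ft q.1 q.2) (mVec W.1 x, W.2)
          (mVec V.1 x, V.2) := by
  have h := (hft (mVec W.1 x, W.2)).hasFDerivAt.comp W (paramCLM p x).hasFDerivAt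
  exact congrArg (fun L => L V) h.fderiv

/-- The input gradient is the transpose of the first layer applied to the gradient with respect
to the hidden preactivations. -/
lemma fderiv_input_eq_mVec_transpose
    (hft : Differentiable ℝ (fun q : (Fin m → ℝ) × (Fin p → ℝ) => ft q.1 q.2))
    (W : (Fin m → Fin d → ℝ) × (Fin p → ℝ)) (x : Fin d → ℝ) :
    (fun j => fderiv ℝ (fun z => ft (mVec W.1 z) W.2) x (Pi.single j 1))
      = mVec (fun s r => W.1 r s) fun r =>
          fderiv ℝ (fun q : (Fin m → ℝ) × (Fin p → ℝ) => ft q.1 q.2) (mVec W.1 x, W.2)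
            (Pi.single r 1, 0) := by
  ext j
  rw [fderiv_comp_input hft, mVec_single]
  have h : ((fun r => W.1 r j, 0) : (Fin m → ℝ) × (Fin p → ℝ))
      = ∑ r, W.1 r j • (Pi.single r 1, 0) := by
    ext i
    · simp [Prod.fst_sum, Finset.sum_apply, Pi.single_apply]
    · simp [Prod.snd_sum]
  rw [h, map_sum]
  simp only [map_smul, smul_eq_mul, mVec]

lemma lpnorm_mul_lpnorm_le_gradWnorm {k : ℕ} (hk : 1 ≤ k)
    (hft : Differentiable ℝ (fun q : (Fin m → ℝ) × (Fin p → ℝ) => ft q.1 q.2))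
    (x : Fin d → ℝ) (W : (Fin m → Fin d → ℝ) × (Fin p → ℝ)) :
    lpnorm k (fun r =>
        fderiv ℝ (fun q : (Fin m → ℝ) × (Fin p → ℝ) => ft q.1 q.2) (mVec W.1 x, W.2)
          (Pi.single r 1, 0)) * lpnorm k x
      ≤ gradWnorm k (fun V => ft (mVec V.1 x) V.2) W := by
  set a : Fin m → ℝ := fun r =>
    fderiv ℝ (fun q : (Fin m → ℝ) × (Fin p → ℝ) => ft q.1 q.2) (mVec W.1 x, W.2)
      (Pi.single r 1, 0) with ha
  have hterm (r : Fin m) (s : Fin d) :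
      fderiv ℝ (fun V : (Fin m → Fin d → ℝ) × (Fin p → ℝ) => ft (mVec V.1 x) V.2) W
        (Pi.single r (Pi.single s 1), 0) = x s * a r := by
    rw [fderiv_comp_param hft, mVec_single_single, ha]
    have h : ((x s • Pi.single r 1, 0) : (Fin m → ℝ) × (Fin p → ℝ))
        = x s • (Pi.single r 1, 0) := by simp
    rw [h, map_smul, smul_eq_mul]
  have hcast : ((2 * k : ℝ))⁻¹ = (((2 * k : ℕ) : ℝ))⁻¹ := by push_cast; rfl
  have hk' : 2 * k ≠ 0 := by omega
  refine le_of_pow_le_pow_left₀ hk' (Real.rpow_nonneg (by positivity) _) ?_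
  rw [gradWnorm, hcast, Real.rpow_inv_natCast_pow (by positivity) hk', mul_pow, lpnorm_pow hk,
    lpnorm_pow hk, Finset.sum_mul_sum]
  refine le_add_of_le_of_nonneg (le_of_eq ?_) (by positivity)
  refine Finset.sum_congr rfl fun r _ => Finset.sum_congr rfl fun s _ => ?_
  rw [hterm, abs_mul, mul_pow, mul_comm]

end Gradients

lemma l2norm_sq {d : ℕ} (v : Fin d → ℝ) : l2norm v ^ 2 = ∑ j, v j ^ 2 :=
  Real.sq_sqrt (by positivity)

/-- A change of input near `y` can be realised by a comparably small rank-one change of the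
first layer. -/
lemma exists_param_mVec_eq {m d p : ℕ} (W : (Fin m → Fin d → ℝ) × (Fin p → ℝ))
    {δ : ℝ} (hδ : 0 ≤ δ) {y : Fin d → ℝ} (hy : y ≠ 0) (x : Fin d → ℝ)
    (hx : l2norm (fun t => x t - y t) ≤ δ * l2norm y / opNorm2 W.1) :
    ∃ W', paramDist W' W ≤ δ ∧ mVec W'.1 y = mVec W.1 x ∧ W'.2 = W.2 := by
  have hypos : 0 < l2norm y := lpnorm_one y ▸ lpnorm_pos le_rfl hy
  have hop : 0 ≤ opNorm2 W.1 := opNormP_one W.1 ▸ opNormP_nonneg 1 W.1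
  set u : Fin m → ℝ := mVec W.1 fun t => x t - y t with hu
  have hu_le : l2norm u ≤ δ * l2norm y := by
    have h := lpnorm_mVec_le le_rfl W.1 fun t => x t - y t
    rw [lpnorm_one, lpnorm_one, opNormP_one] at h
    refine h.trans ?_
    rcases hop.eq_or_lt with h0 | h0
    · rw [← h0, zero_mul]
      positivity
    · rwa [le_div_iff₀ h0, mul_comm] at hx
  refine ⟨(fun r s => W.1 r s + u r * y s / l2norm y ^ 2, W.2), ?_, ?_, rfl⟩
  · have h : paramDist (fun r s => W.1 r s + u r * y s / l2norm y ^ 2, W.2) W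
        = l2norm u / l2norm y := by
      have hsum : ∑ r, ∑ s, (u r * y s / l2norm y ^ 2) ^ 2 = (l2norm u / l2norm y) ^ 2 := by
        have hrs (r : Fin m) (s : Fin d) : (u r * y s / l2norm y ^ 2) ^ 2
            = u r ^ 2 * y s ^ 2 / l2norm y ^ 4 := by ring
        simp only [hrs, ← Finset.sum_div]
        rw [← Finset.sum_mul_sum, ← l2norm_sq, ← l2norm_sq]
        field_simp
      simp only [paramDist, add_sub_cancel_left, sub_self, hsum]
      rw [zero_pow two_ne_zero, Finset.sum_const_zero, add_zero]
      exact Real.sqrt_sq (div_nonneg (Real.sqrt_nonneg _) hypos.le)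
    rwa [h, div_le_iff₀ hypos]
  · ext r
    have hrank : ∑ s, u r * y s / l2norm y ^ 2 * y s = u r := by
      have hs (s : Fin d) : u r * y s / l2norm y ^ 2 * y s
          = u r / l2norm y ^ 2 * y s ^ 2 := by ring
      simp only [hs]
      rw [← Finset.mul_sum, ← l2norm_sq]
      field_simp
    simp only [mVec, add_mul, Finset.sum_add_distrib, hrank]
    simp [hu, mVec, mul_sub]

/-- under the `(C, δ_approx, k)`-local smoothness condition at `(x*, W*)`, for
every `x` with `‖x − x*‖₂ ≤ δ_approx ‖x*‖₂/‖W₁*‖₂` one has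
`‖∇_x f(x, W*)‖_{2k} ≤ (C‖(W₁*)ᵀ‖_{2k}/‖x*‖_{2k}) (‖∇_W f(x*, W*)‖_{2k} + 1)`. -/
theorem grad_bound_near_training_point
    {m d p : ℕ} (k : ℕ) (hk : 1 ≤ k)
    (C δa : ℝ) (hC : 0 < C) (hδa : 0 < δa)
    (ft : (Fin m → ℝ) → (Fin p → ℝ) → ℝ)
    (hft : Differentiable ℝ (fun q : (Fin m → ℝ) × (Fin p → ℝ) => ft q.1 q.2))
    (Wstar : (Fin m → Fin d → ℝ) × (Fin p → ℝ))
    (xs : Fin d → ℝ) (hxs : xs ≠ 0)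
    (hsmooth : ∀ W' : (Fin m → Fin d → ℝ) × (Fin p → ℝ), paramDist W' Wstar ≤ δa →
      gradWnorm k (fun V => ft (mVec V.1 xs) V.2) W'
        ≤ C * (gradWnorm k (fun V => ft (mVec V.1 xs) V.2) Wstar + 1))
    (x : Fin d → ℝ)
    (hx : l2norm (fun t => x t - xs t) ≤ δa * l2norm xs / opNorm2 Wstar.1) :
    lpnorm k (fun j => fderiv ℝ (fun z => ft (mVec Wstar.1 z) Wstar.2) x (Pi.single j 1))
      ≤ C * opNormP k (fun s r => Wstar.1 r s) / lpnorm k xs *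
        (gradWnorm k (fun V => ft (mVec V.1 xs) V.2) Wstar + 1) := by
  obtain ⟨W', hdist, hW₁, hW₂⟩ := exists_param_mVec_eq Wstar hδa.le hxs x hx
  have hgrad := (lpnorm_mul_lpnorm_le_gradWnorm hk hft xs W').trans (hsmooth W' hdist)
  rw [hW₁, hW₂, ← le_div_iff₀ (lpnorm_pos hk hxs)] at hgrad
  rw [fderiv_input_eq_mVec_transpose hft]
  refine (lpnorm_mVec_le hk _ _).trans
    ((mul_le_mul_of_nonneg_left hgrad (opNormP_nonneg k _)).trans_eq ?_)
  ring
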